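/- For every p ≥ 1, the p-th moment of the free Poisson distribution of parameter c equals ∑_{σ ∈ NC(p)} c^{#σ}, the sum over non-crossing partitions of {1,…,p} of c raised to the number of blocks. -/

import Mathlib

open MeasureTheory

open scoped Classical

/-- The free Poisson (Marchenko–Pastur) distribution of parameter `c`. -/
noncomputable def freePoisson (c : ℝ) : Measure ℝ :=
  ENNReal.ofReal (max (1 - c) 0) • Measure.dirac 0 +
    volume.withDensity (fun x =>
      ENNReal.ofReal
        (if x ∈ Set.Icc (1 + c - 2 * Real.sqrt c) (1 + c + 2 * Real.sqrt c)
          then Real.sqrt (4 * c - (x - 1 - c) ^ 2) / (2 * Real.pi * x) else 0))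

/-- `S` is a non-crossing partition of `{1,…,p}`, encoded as its finite set of blocks:
the blocks are nonempty, every point lies in exactly one block, and no two blocks cross. -/
def IsNCPartition {p : ℕ} (S : Finset (Finset (Fin p))) : Prop :=
  (∀ B ∈ S, B.Nonempty) ∧ (∀ x : Fin p, ∃! B, B ∈ S ∧ x ∈ B) ∧
    (∀ a b c d : Fin p, a < b → b < c → c < d →
      ∀ B ∈ S, ∀ B' ∈ S, a ∈ B → c ∈ B → b ∈ B' → d ∈ B' → B = B')


structure NCI (a b : ℕ) (S : Finset (Finset ℕ)) : Prop where
  ne : ∀ B ∈ S, B.Nonempty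
  sub : ∀ B ∈ S, ∀ x ∈ B, a ≤ x ∧ x < b
  cov : ∀ x, a ≤ x → x < b → ∃ B ∈ S, x ∈ B
  dis : ∀ B ∈ S, ∀ B' ∈ S, ∀ x, x ∈ B → x ∈ B' → B = B'
  nc : ∀ p q r s : ℕ, p < q → q < r → r < s →
      ∀ B ∈ S, ∀ B' ∈ S, p ∈ B → r ∈ B → q ∈ B' → s ∈ B' → B = B'

noncomputable def ncs (a b : ℕ) : Finset (Finset (Finset ℕ)) :=
  (Finset.Ico a b).powerset.powerset.filter (fun S => NCI a b S)

theorem mem_ncs {a b : ℕ} {S : Finset (Finset ℕ)} : S ∈ ncs a b ↔ NCI a b S := by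
  unfold ncs
  rw [Finset.mem_filter, and_iff_right_iff_imp]
  intro h
  rw [Finset.mem_powerset]
  intro B hB
  rw [Finset.mem_powerset]
  intro x hx
  rw [Finset.mem_Ico]
  exact h.sub B hB x hx

noncomputable def ncF (c : ℝ) (a b : ℕ) : ℝ := ∑ S ∈ ncs a b, c ^ S.card

def NxtA (a j : ℕ) (S : Finset (Finset ℕ)) : Prop :=
  ∃ B ∈ S, a ∈ B ∧ j ∈ B ∧ ∀ x ∈ B, a < x → j ≤ x

theorem key_split {a b j : ℕ} (haj : a < j) {S : Finset (Finset ℕ)}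
    (h : NCI a b S) (hn : NxtA a j S) : ∀ B ∈ S,
    (∀ x ∈ B, a < x ∧ x < j) ∨ (∀ x ∈ B, x = a ∨ j ≤ x) := by
  obtain ⟨B0, hB0, ha, hj, hmin⟩ := hn
  intro B hB
  by_contra hcon
  push Not at hcon
  obtain ⟨⟨x, hx, hx'⟩, ⟨y, hy, hya, hyj⟩⟩ := hcon
  have hy1 := (h.sub B hB y hy).1
  have hx1 := (h.sub B hB x hx).1
  have hBB : B ≠ B0 := by
    rintro rfl
    have := hmin y hy (by omega)
    omega
  apply hBB
  rcases eq_or_lt_of_le hx1 with e | e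
  · subst e; exact h.dis _ hB _ hB0 _ hx ha
  · have := hx' e
    rcases eq_or_lt_of_le this with e | e
    · subst e; exact h.dis _ hB _ hB0 _ hx hj
    · exact (h.nc a y j x (by omega) hyj e B0 hB0 B hB ha hj hy hx).symm

noncomputable def lft (a j : ℕ) (S : Finset (Finset ℕ)) : Finset (Finset ℕ) :=
  S.filter (fun B => ∀ x ∈ B, a < x ∧ x < j)
noncomputable def rgt (a j : ℕ) (S : Finset (Finset ℕ)) : Finset (Finset ℕ) :=
  (S.filter (fun B => ∀ x ∈ B, x = a ∨ j ≤ x)).image (fun B => B.erase a)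
noncomputable def addA (a j : ℕ) (B : Finset ℕ) : Finset ℕ := if j ∈ B then insert a B else B
noncomputable def glu (a j : ℕ) (S T : Finset (Finset ℕ)) : Finset (Finset ℕ) :=
  S ∪ T.image (addA a j)

theorem mem_rgt {a j : ℕ} {S : Finset (Finset ℕ)} {B : Finset ℕ} :
    B ∈ rgt a j S ↔ ∃ C ∈ S, (∀ x ∈ C, x = a ∨ j ≤ x) ∧ C.erase a = B := by
  simp [rgt, and_assoc]

theorem mem_lft {a j : ℕ} {S : Finset (Finset ℕ)} {B : Finset ℕ} :
    B ∈ lft a j S ↔ B ∈ S ∧ (∀ x ∈ B, a < x ∧ x < j) := by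
  simp [lft]

theorem mem_glu {a j : ℕ} {S T : Finset (Finset ℕ)} {B : Finset ℕ} :
    B ∈ glu a j S T ↔ B ∈ S ∨ ∃ C ∈ T, addA a j C = B := by
  simp [glu]

theorem mem_addA {a j x : ℕ} {B : Finset ℕ} : x ∈ addA a j B ↔ x ∈ B ∨ (x = a ∧ j ∈ B) := by
  unfold addA; split_ifs <;> simp <;> tauto

theorem nci_lft {a b j : ℕ} (haj : a < j) (hjb : j < b) {S : Finset (Finset ℕ)}
    (h : NCI a b S) (hn : NxtA a j S) : NCI (a+1) j (lft a j S) := by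
  have key := key_split haj h hn
  refine ⟨fun B hB => h.ne B (mem_lft.1 hB).1, fun B hB x hx => (mem_lft.1 hB).2 x hx, ?_, ?_, ?_⟩
  · intro x h1 h2
    obtain ⟨B, hB, hx⟩ := h.cov x (by omega) (by omega)
    refine ⟨B, mem_lft.2 ⟨hB, ?_⟩, hx⟩
    rcases key B hB with k | k
    · exact k
    · have := k x hx; omega
  · intro B hB B' hB'
    exact h.dis B (mem_lft.1 hB).1 B' (mem_lft.1 hB').1
  · intro p q r s h1 h2 h3 B hB B' hB'
    exact h.nc p q r s h1 h2 h3 B (mem_lft.1 hB).1 B' (mem_lft.1 hB').1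

theorem nci_rgt {a b j : ℕ} (haj : a < j) {S : Finset (Finset ℕ)}
    (h : NCI a b S) (hn : NxtA a j S) : NCI j b (rgt a j S) := by
  have key := key_split haj h hn
  obtain ⟨B0, hB0, ha, hj, hmin⟩ := hn
  refine ⟨?_, ?_, ?_, ?_, ?_⟩
  · intro B hB
    obtain ⟨C, hC, hC2, rfl⟩ := mem_rgt.1 hB
    obtain ⟨x, hx⟩ := h.ne C hC
    by_cases e : x = a
    · subst e
      have := h.dis _ hC _ hB0 _ hx ha
      subst this
      exact ⟨j, by simp [hj]; omega⟩
    · exact ⟨x, by simp [hx, e]⟩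
  · intro B hB x hx
    obtain ⟨C, hC, hC2, rfl⟩ := mem_rgt.1 hB
    rw [Finset.mem_erase] at hx
    have := hC2 x hx.2
    have := h.sub C hC x hx.2
    omega
  · intro x h1 h2
    obtain ⟨B, hB, hx⟩ := h.cov x (by omega) (by omega)
    refine ⟨B.erase a, mem_rgt.2 ⟨B, hB, ?_, rfl⟩, by simp [hx]; omega⟩
    rcases key B hB with k | k
    · have := k x hx; omega
    · exact k
  · intro B hB B' hB' x hx hx'
    obtain ⟨C, hC, hC2, rfl⟩ := mem_rgt.1 hB
    obtain ⟨C', hC', hC2', rfl⟩ := mem_rgt.1 hB'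
    rw [Finset.mem_erase] at hx hx'
    rw [h.dis C hC C' hC' x hx.2 hx'.2]
  · intro p q r s h1 h2 h3 B hB B' hB' hx1 hx2 hx3 hx4
    obtain ⟨C, hC, hC2, rfl⟩ := mem_rgt.1 hB
    obtain ⟨C', hC', hC2', rfl⟩ := mem_rgt.1 hB'
    rw [Finset.mem_erase] at hx1 hx2 hx3 hx4
    rw [h.nc p q r s h1 h2 h3 C hC C' hC' hx1.2 hx2.2 hx3.2 hx4.2]

theorem nci_glu {a b j : ℕ} (haj : a < j) (hjb : j < b) {S T : Finset (Finset ℕ)}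
    (h : NCI (a+1) j S) (h' : NCI j b T) : NCI a b (glu a j S T) ∧ NxtA a j (glu a j S T) := by
  refine ⟨⟨?_, ?_, ?_, ?_, ?_⟩, ?_⟩
  · intro B hB
    rcases mem_glu.1 hB with hB | ⟨C, hC, rfl⟩
    · exact h.ne B hB
    · obtain ⟨x, hx⟩ := h'.ne C hC
      exact ⟨x, mem_addA.2 (Or.inl hx)⟩
  · intro B hB x hx
    rcases mem_glu.1 hB with hB | ⟨C, hC, rfl⟩
    · have := h.sub B hB x hx; omega
    · rcases mem_addA.1 hx with hx | hx
      · have := h'.sub C hC x hx; omega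
      · omega
  · intro x h1 h2
    rcases eq_or_lt_of_le h1 with e | e
    · subst e
      obtain ⟨B, hB, hx⟩ := h'.cov j le_rfl hjb
      exact ⟨_, mem_glu.2 (Or.inr ⟨B, hB, rfl⟩), mem_addA.2 (Or.inr ⟨rfl, hx⟩)⟩
    · by_cases e' : x < j
      · obtain ⟨B, hB, hx⟩ := h.cov x e e'
        exact ⟨_, mem_glu.2 (Or.inl hB), hx⟩
      · obtain ⟨B, hB, hx⟩ := h'.cov x (by omega) (by omega)
        exact ⟨_, mem_glu.2 (Or.inr ⟨B, hB, rfl⟩), mem_addA.2 (Or.inl hx)⟩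
  · intro B hB B' hB' x hx hx'
    rcases mem_glu.1 hB with hB | ⟨C, hC, rfl⟩ <;> rcases mem_glu.1 hB' with hB' | ⟨C', hC', rfl⟩
    · exact h.dis B hB B' hB' x hx hx'
    · have := h.sub B hB x hx
      rcases mem_addA.1 hx' with hx' | hx'
      · have := h'.sub _ hC' x hx'; omega
      · omega
    · have := h.sub B' hB' x hx'
      rcases mem_addA.1 hx with hx | hx
      · have := h'.sub _ hC x hx; omega
      · omega
    · congr 1
      rcases mem_addA.1 hx with hx | hx <;> rcases mem_addA.1 hx' with hx' | hx'
      · exact h'.dis _ hC _ hC' _ hx hx'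
      · have := h'.sub _ hC x hx; omega
      · have := h'.sub _ hC' x hx'; omega
      · exact h'.dis _ hC _ hC' _ hx.2 hx'.2
  · intro p q r s h1 h2 h3 B hB B' hB' hx1 hx2 hx3 hx4
    rcases mem_glu.1 hB with hB | ⟨C, hC, rfl⟩ <;> rcases mem_glu.1 hB' with hB' | ⟨C', hC', rfl⟩
    · exact h.nc p q r s h1 h2 h3 B hB B' hB' hx1 hx2 hx3 hx4
    · have := h.sub B hB _ hx1
      have := h.sub B hB _ hx2
      rcases mem_addA.1 hx3 with hx | hx
      · have := h'.sub _ hC' _ hx; omega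
      · omega
    · have := h.sub B' hB' _ hx3
      have := h.sub B' hB' _ hx4
      rcases mem_addA.1 hx2 with hx | hx
      · have := h'.sub _ hC _ hx; omega
      · omega
    · congr 1
      have hge : ∀ D ∈ T, ∀ x ∈ D, j ≤ x := fun D hD x hx => (h'.sub D hD x hx).1
      have f : ∀ D ∈ T, ∀ x ∈ addA a j D, a < x → x ∈ D := by
        intro D hD x hx hax
        rcases mem_addA.1 hx with hx | hx
        · exact hx
        · omega
      have ap : a ≤ p := by
        rcases mem_addA.1 hx1 with hx | hx
        · have := hge _ hC _ hx; omega
        · omega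
      have k3 := f _ hC' q hx3 (by omega)
      have k2 := f _ hC r hx2 (by omega)
      have k4 := f _ hC' s hx4 (by omega)
      rcases mem_addA.1 hx1 with hx | hx
      · exact h'.nc p q r s h1 h2 h3 C hC C' hC' hx k2 k3 k4
      · rcases eq_or_lt_of_le (hge _ hC' _ k3) with e | e
        · subst e; exact h'.dis _ hC _ hC' _ hx.2 k3
        · exact h'.nc j q r s e h2 h3 C hC C' hC' hx.2 k2 k3 k4
  · obtain ⟨B, hB, hx⟩ := h'.cov j le_rfl hjb
    refine ⟨_, mem_glu.2 (Or.inr ⟨B, hB, rfl⟩), mem_addA.2 (Or.inr ⟨rfl, hx⟩), mem_addA.2 (Or.inl hx), ?_⟩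
    intro x hx hax
    rcases mem_addA.1 hx with hx | hx
    · exact (h'.sub _ hB _ hx).1
    · omega

theorem glu_lft_rgt {a b j : ℕ} (haj : a < j) {S : Finset (Finset ℕ)}
    (h : NCI a b S) (hn : NxtA a j S) : glu a j (lft a j S) (rgt a j S) = S := by
  have key := key_split haj h hn
  obtain ⟨B0, hB0, ha, hj, hmin⟩ := hn
  have aux : ∀ C ∈ S, addA a j (C.erase a) = C := by
    intro C hC
    ext x
    rw [mem_addA, Finset.mem_erase, Finset.mem_erase]
    constructor
    · rintro (⟨-, h1⟩ | ⟨rfl, -, h1⟩)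
      · exact h1
      · rwa [h.dis _ hC _ hB0 _ h1 hj]
    · intro hx
      by_cases e : x = a
      · subst e
        right
        refine ⟨rfl, by omega, ?_⟩
        rwa [h.dis _ hC _ hB0 _ hx ha]
      · exact Or.inl ⟨e, hx⟩
  ext B
  rw [mem_glu]
  constructor
  · rintro (hB | ⟨C, hC, rfl⟩)
    · exact (mem_lft.1 hB).1
    · obtain ⟨D, hD, -, rfl⟩ := mem_rgt.1 hC
      rwa [aux D hD]
  · intro hB
    rcases key B hB with k | k
    · exact Or.inl (mem_lft.2 ⟨hB, k⟩)
    · exact Or.inr ⟨_, mem_rgt.2 ⟨B, hB, k, rfl⟩, aux B hB⟩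

theorem erase_addA {a b j : ℕ} (haj : a < j) {T : Finset (Finset ℕ)}
    (h' : NCI j b T) : ∀ C ∈ T, (addA a j C).erase a = C := by
  intro C hC
  ext x
  rw [Finset.mem_erase, mem_addA]
  constructor
  · rintro ⟨h1, h2 | h2⟩
    · exact h2
    · exact absurd h2.1 h1
  · intro hx
    have := h'.sub _ hC _ hx
    exact ⟨by omega, Or.inl hx⟩

theorem lft_glu {a b j : ℕ} (haj : a < j) {S T : Finset (Finset ℕ)}
    (h : NCI (a+1) j S) (h' : NCI j b T) : lft a j (glu a j S T) = S := by
  ext B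
  rw [mem_lft, mem_glu]
  constructor
  · rintro ⟨hB | ⟨C, hC, rfl⟩, hB2⟩
    · exact hB
    · obtain ⟨x, hx⟩ := h'.ne _ hC
      have := hB2 x (mem_addA.2 (Or.inl hx))
      have := h'.sub _ hC _ hx
      omega
  · intro hB
    exact ⟨Or.inl hB, fun x hx => h.sub _ hB _ hx⟩

theorem rgt_glu {a b j : ℕ} (haj : a < j) {S T : Finset (Finset ℕ)}
    (h : NCI (a+1) j S) (h' : NCI j b T) : rgt a j (glu a j S T) = T := by
  ext B
  rw [mem_rgt]
  constructor
  · rintro ⟨C, hC, hC2, rfl⟩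
    rcases mem_glu.1 hC with hC | ⟨D, hD, rfl⟩
    · obtain ⟨x, hx⟩ := h.ne _ hC
      have := hC2 x hx
      have := h.sub _ hC _ hx
      omega
    · rwa [erase_addA haj h' D hD]
  · intro hB
    refine ⟨_, mem_glu.2 (Or.inr ⟨B, hB, rfl⟩), ?_, erase_addA haj h' B hB⟩
    intro x hx
    rcases mem_addA.1 hx with hx | hx
    · exact Or.inr (h'.sub _ hB _ hx).1
    · exact Or.inl hx.1

theorem card_glu {a b j : ℕ} (haj : a < j) {S T : Finset (Finset ℕ)}
    (h : NCI (a+1) j S) (h' : NCI j b T) : (glu a j S T).card = S.card + T.card := by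
  unfold glu
  rw [Finset.card_union_of_disjoint, Finset.card_image_of_injOn]
  · intro B hB C hC e
    rw [← erase_addA haj h' B hB, ← erase_addA haj h' C hC]
    exact congrArg (fun D => D.erase a) e
  · rw [Finset.disjoint_left]
    intro B hB hB'
    rw [Finset.mem_image] at hB'
    obtain ⟨C, hC, rfl⟩ := hB'
    obtain ⟨x, hx⟩ := h'.ne _ hC
    have := h.sub _ hB _ (mem_addA.2 (Or.inl hx))
    have := h'.sub _ hC _ hx
    omega

theorem sum_nxt (c : ℝ) {a b j : ℕ} (haj : a < j) (hjb : j < b) :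
    ∑ S ∈ (ncs a b).filter (fun S => NxtA a j S), c ^ S.card = ncF c (a+1) j * ncF c j b := by
  unfold ncF
  rw [Finset.sum_mul_sum, ← Finset.sum_product']
  symm
  refine Finset.sum_bij' (fun P _ => glu a j P.1 P.2) (fun S _ => (lft a j S, rgt a j S)) ?_ ?_ ?_ ?_ ?_
  · rintro ⟨S, T⟩ h
    rw [Finset.mem_product, mem_ncs, mem_ncs] at h
    rw [Finset.mem_filter, mem_ncs]
    exact nci_glu haj hjb h.1 h.2
  · intro S h
    rw [Finset.mem_filter, mem_ncs] at h
    rw [Finset.mem_product, mem_ncs, mem_ncs]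
    exact ⟨nci_lft haj hjb h.1 h.2, nci_rgt haj h.1 h.2⟩
  · rintro ⟨S, T⟩ h
    rw [Finset.mem_product, mem_ncs, mem_ncs] at h
    exact Prod.ext (lft_glu haj h.1 h.2) (rgt_glu haj h.1 h.2)
  · intro S h
    rw [Finset.mem_filter, mem_ncs] at h
    exact glu_lft_rgt haj h.1 h.2
  · rintro ⟨S, T⟩ h
    rw [Finset.mem_product, mem_ncs, mem_ncs] at h
    rw [card_glu haj h.1 h.2, pow_add]

theorem nci_erase {a b : ℕ} {S : Finset (Finset ℕ)} (h : NCI a b S) (hs : {a} ∈ S) :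
    NCI (a+1) b (S.erase {a}) := by
  refine ⟨fun B hB => h.ne B (Finset.mem_of_mem_erase hB), ?_, ?_,
    fun B hB B' hB' => h.dis B (Finset.mem_of_mem_erase hB) B' (Finset.mem_of_mem_erase hB'),
    fun p q r s h1 h2 h3 B hB B' hB' => h.nc p q r s h1 h2 h3 B (Finset.mem_of_mem_erase hB) B' (Finset.mem_of_mem_erase hB')⟩
  · intro B hB x hx
    rw [Finset.mem_erase] at hB
    have := h.sub _ hB.2 _ hx
    have : x ≠ a := by
      rintro rfl
      exact hB.1 (h.dis _ hB.2 _ hs _ hx (by simp))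
    omega
  · intro x h1 h2
    obtain ⟨B, hB, hx⟩ := h.cov x (by omega) (by omega)
    refine ⟨B, Finset.mem_erase.2 ⟨?_, hB⟩, hx⟩
    rintro rfl
    simp at hx
    omega

theorem notmem_single {a b : ℕ} {S : Finset (Finset ℕ)} (h : NCI (a+1) b S) : {a} ∉ S := by
  intro hs
  have := h.sub _ hs a (by simp)
  omega

theorem nci_insert {a b : ℕ} (hab : a < b) {S : Finset (Finset ℕ)} (h : NCI (a+1) b S) :
    NCI a b (insert {a} S) := by
  refine ⟨?_, ?_, ?_, ?_, ?_⟩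
  · intro B hB
    rcases Finset.mem_insert.1 hB with rfl | hB
    · simp
    · exact h.ne _ hB
  · intro B hB x hx
    rcases Finset.mem_insert.1 hB with rfl | hB
    · simp at hx; omega
    · have := h.sub _ hB _ hx; omega
  · intro x h1 h2
    rcases eq_or_lt_of_le h1 with rfl | e
    · exact ⟨_, Finset.mem_insert_self _ _, by simp⟩
    · obtain ⟨B, hB, hx⟩ := h.cov x (by omega) (by omega)
      exact ⟨B, Finset.mem_insert_of_mem hB, hx⟩
  · intro B hB B' hB' x hx hx'
    rcases Finset.mem_insert.1 hB with rfl | hB <;> rcases Finset.mem_insert.1 hB' with rfl | hB'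
    · rfl
    · have := h.sub _ hB' _ hx'; simp at hx; omega
    · have := h.sub _ hB _ hx; simp at hx'; omega
    · exact h.dis _ hB _ hB' _ hx hx'
  · intro p q r s h1 h2 h3 B hB B' hB' hx1 hx2 hx3 hx4
    rcases Finset.mem_insert.1 hB with rfl | hB <;> rcases Finset.mem_insert.1 hB' with rfl | hB'
    · rfl
    · simp at hx1 hx2; omega
    · simp at hx3 hx4; omega
    · exact h.nc p q r s h1 h2 h3 _ hB _ hB' hx1 hx2 hx3 hx4

theorem sum_single (c : ℝ) {a b : ℕ} (hab : a < b) :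
    ∑ S ∈ (ncs a b).filter (fun S => {a} ∈ S), c ^ S.card = c * ncF c (a+1) b := by
  unfold ncF
  rw [Finset.mul_sum]
  symm
  refine Finset.sum_bij' (fun S _ => insert {a} S) (fun S _ => S.erase {a}) ?_ ?_ ?_ ?_ ?_
  · intro S h
    rw [mem_ncs] at h
    rw [Finset.mem_filter, mem_ncs]
    exact ⟨nci_insert hab h, Finset.mem_insert_self _ _⟩
  · intro S h
    rw [Finset.mem_filter, mem_ncs] at h
    rw [mem_ncs]
    exact nci_erase h.1 h.2
  · intro S h
    rw [mem_ncs] at h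
    exact Finset.erase_insert (notmem_single h)
  · intro S h
    rw [Finset.mem_filter] at h
    exact Finset.insert_erase h.2
  · intro S h
    rw [mem_ncs] at h
    rw [Finset.card_insert_of_notMem (notmem_single h), pow_succ']

theorem ncF_rec (c : ℝ) {a b : ℕ} (hab : a < b) :
    ncF c a b = c * ncF c (a+1) b + ∑ j ∈ Finset.Ioo a b, ncF c (a+1) j * ncF c j b := by
  rw [← sum_single c hab]
  have e : ∑ j ∈ Finset.Ioo a b, ncF c (a+1) j * ncF c j b =
      ∑ S ∈ (Finset.Ioo a b).biUnion (fun j => (ncs a b).filter (fun S => NxtA a j S)), c ^ S.card := by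
    rw [Finset.sum_biUnion]
    · refine Finset.sum_congr rfl fun j hj => ?_
      rw [Finset.mem_Ioo] at hj
      rw [sum_nxt c hj.1 hj.2]
    · intro i hi j hj hij
      rw [Finset.mem_coe, Finset.mem_Ioo] at hi hj
      simp only [Function.onFun]
      rw [Finset.disjoint_left]
      intro S h1 h2
      rw [Finset.mem_filter, mem_ncs] at h1 h2
      obtain ⟨h, B, hB, k1, k2, k3⟩ := h1
      obtain ⟨-, B', hB', k1', k2', k3'⟩ := h2
      have := h.dis _ hB _ hB' _ k1 k1'
      subst this
      have := k3 _ k2' hj.1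
      have := k3' _ k2 hi.1
      omega
  rw [e, ← Finset.sum_union]
  · unfold ncF
    refine Finset.sum_congr ?_ fun _ _ => rfl
    ext S
    simp only [Finset.mem_union, Finset.mem_biUnion, Finset.mem_filter, Finset.mem_Ioo]
    constructor
    · intro hS
      have h := mem_ncs.1 hS
      obtain ⟨B, hB, ha⟩ := h.cov a le_rfl hab
      by_cases e : (B.erase a).Nonempty
      · right
        have hm := Finset.min'_mem _ e
        rw [Finset.mem_erase] at hm
        have := h.sub _ hB _ hm.2
        refine ⟨(B.erase a).min' e, by omega, hS, B, hB, ha, hm.2, ?_⟩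
        intro x hx hax
        exact Finset.min'_le _ _ (Finset.mem_erase.2 ⟨by omega, hx⟩)
      · left
        refine ⟨hS, ?_⟩
        rw [Finset.not_nonempty_iff_eq_empty] at e
        have : B = {a} := by rw [← Finset.insert_erase ha, e]; simp
        rwa [← this]
    · rintro (h | ⟨j, -, h⟩) <;> exact h.1
  · rw [Finset.disjoint_left]
    intro S h1 h2
    rw [Finset.mem_biUnion] at h2
    obtain ⟨j, hj, h2⟩ := h2
    rw [Finset.mem_Ioo] at hj
    rw [Finset.mem_filter, mem_ncs] at h1 h2
    obtain ⟨h, B, hB, k1, k2, k3⟩ := h2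
    have := h.dis _ hB _ h1.2 a k1 (by simp)
    subst this
    simp at k2
    omega

theorem ncF_self (c : ℝ) (a : ℕ) : ncF c a a = 1 := by
  have : ncs a a = {∅} := by
    ext S
    rw [mem_ncs, Finset.mem_singleton]
    constructor
    · intro h
      rw [Finset.eq_empty_iff_forall_notMem]
      intro B hB
      obtain ⟨x, hx⟩ := h.ne _ hB
      have := h.sub _ hB _ hx
      omega
    · rintro rfl
      exact ⟨by simp, by simp, by intros; omega, by simp, by simp⟩
  simp [ncF, this]

theorem ncF_shift (c : ℝ) : ∀ n a : ℕ, ncF c a (a+n) = ncF c 0 n := by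
  intro n
  induction n using Nat.strong_induction_on with
  | _ n ih =>
    intro a
    rcases Nat.eq_zero_or_pos n with rfl | hn
    · simp [ncF_self]
    · have g : ∀ a b m, b = a + m → m < n → ncF c a b = ncF c 0 m := by
        rintro a b m rfl hm
        exact ih m hm a
      rw [ncF_rec c (show a < a + n by omega), ncF_rec c hn, g (a+1) (a+n) (n-1) (by omega) (by omega),
        g (0+1) n (n-1) (by omega) (by omega)]
      congr 1
      symm
      refine Finset.sum_bij' (fun j _ => a + j) (fun j _ => j - a) ?_ ?_ ?_ ?_ ?_
      · intro j hj; rw [Finset.mem_Ioo] at *; omega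
      · intro j hj; rw [Finset.mem_Ioo] at *; omega
      · intro j hj; rw [Finset.mem_Ioo] at *; omega
      · intro j hj; rw [Finset.mem_Ioo] at *; omega
      · intro j hj
        rw [Finset.mem_Ioo] at hj
        rw [g (0+1) j (j-1) (by omega) (by omega), g (a+1) (a+j) (j-1) (by omega) (by omega),
          g j n (n-j) (by omega) (by omega), g (a+j) (a+n) (n-j) (by omega) (by omega)]

theorem ncF_conv (c : ℝ) (n : ℕ) : ncF c 0 (n+1) = (c - 1) * ncF c 0 n +
    ∑ k ∈ Finset.range (n+1), ncF c 0 k * ncF c 0 (n-k) := by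
  have g : ∀ a b m, b = a + m → ncF c a b = ncF c 0 m := by
    rintro a b m rfl
    exact ncF_shift c m a
  rw [ncF_rec c (Nat.succ_pos n), g (0+1) (n+1) n (by omega), Finset.sum_range_succ]
  have : ∑ j ∈ Finset.Ioo 0 (n+1), ncF c (0+1) j * ncF c j (n+1) =
      ∑ k ∈ Finset.range n, ncF c 0 k * ncF c 0 (n-k) := by
    refine Finset.sum_bij' (fun j _ => j - 1) (fun j _ => j + 1) ?_ ?_ ?_ ?_ ?_
    · intro j hj; rw [Finset.mem_Ioo] at hj; rw [Finset.mem_range]; omega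
    · intro j hj; rw [Finset.mem_Ioo]; rw [Finset.mem_range] at hj; omega
    · intro j hj; rw [Finset.mem_Ioo] at hj; omega
    · intro j hj; omega
    · intro j hj
      rw [Finset.mem_Ioo] at hj
      rw [g (0+1) j (j-1) (by omega), g j (n+1) (n-(j-1)) (by omega)]
  rw [this, Nat.sub_self, ncF_self]
  ring

theorem ncF_eq (c : ℝ) (p : ℕ) : ncF c 0 p =
    ∑ S ∈ Finset.univ.filter (fun S : Finset (Finset (Fin p)) => IsNCPartition S), c ^ S.card := by
  symm
  unfold ncF
  have inj : Function.Injective (fun B : Finset (Fin p) => B.map Fin.valEmbedding) :=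
    Finset.map_injective _
  refine Finset.sum_bij (fun S _ => S.map ⟨_, inj⟩) ?_ ?_ ?_ ?_
  · intro S h
    rw [Finset.mem_filter] at h
    obtain ⟨-, h1, h2, h3⟩ := h
    rw [mem_ncs]
    refine ⟨?_, ?_, ?_, ?_, ?_⟩
    · intro B hB
      obtain ⟨C, hC, rfl⟩ := Finset.mem_map.1 hB
      exact (h1 C hC).map
    · intro B hB x hx
      obtain ⟨C, hC, rfl⟩ := Finset.mem_map.1 hB
      obtain ⟨y, hy, rfl⟩ := Finset.mem_map.1 hx
      exact ⟨Nat.zero_le _, y.2⟩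
    · intro x _ hx
      obtain ⟨B, ⟨hB, hxB⟩, -⟩ := h2 ⟨x, hx⟩
      exact ⟨_, Finset.mem_map_of_mem _ hB, Finset.mem_map_of_mem Fin.valEmbedding hxB⟩
    · intro B hB B' hB' x hx hx'
      obtain ⟨C, hC, rfl⟩ := Finset.mem_map.1 hB
      obtain ⟨C', hC', rfl⟩ := Finset.mem_map.1 hB'
      obtain ⟨y, hy, rfl⟩ := Finset.mem_map.1 hx
      have hy' := (Finset.mem_map' Fin.valEmbedding).1 hx'
      rw [(h2 y).unique ⟨hC, hy⟩ ⟨hC', hy'⟩]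
    · intro p q r s l1 l2 l3 B hB B' hB' hp hr hq hs
      obtain ⟨C, hC, rfl⟩ := Finset.mem_map.1 hB
      obtain ⟨C', hC', rfl⟩ := Finset.mem_map.1 hB'
      obtain ⟨p', kp, rfl⟩ := Finset.mem_map.1 hp
      obtain ⟨q', kq, rfl⟩ := Finset.mem_map.1 hq
      obtain ⟨r', kr, rfl⟩ := Finset.mem_map.1 hr
      obtain ⟨s', ks, rfl⟩ := Finset.mem_map.1 hs
      rw [h3 p' q' r' s' l1 l2 l3 C hC C' hC' kp kr kq ks]
  · intro S _ T _ e
    exact Finset.map_injective _ e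
  · intro T hT
    rw [mem_ncs] at hT
    refine ⟨Finset.univ.filter (fun B => B.map Fin.valEmbedding ∈ T), ?_, ?_⟩
    · have memf : ∀ B : Finset (Fin p), B ∈ Finset.univ.filter (fun B : Finset (Fin p) => B.map Fin.valEmbedding ∈ T) ↔
        B.map Fin.valEmbedding ∈ T := by intro B; simp
      have lift : ∀ B ∈ T, ∃ C : Finset (Fin p), C.map Fin.valEmbedding = B := by
        intro B hB
        refine ⟨Finset.univ.filter (fun x => (x:ℕ) ∈ B), ?_⟩
        ext x
        simp only [Finset.mem_map, Finset.mem_filter, Finset.mem_univ, true_and]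
        constructor
        · rintro ⟨y, hy, rfl⟩; exact hy
        · intro hx; exact ⟨⟨x, (hT.sub _ hB _ hx).2⟩, hx, rfl⟩
      rw [Finset.mem_filter]
      refine ⟨Finset.mem_univ _, ?_, ?_, ?_⟩
      · intro B hB
        rw [memf] at hB
        exact Finset.map_nonempty.1 (hT.ne _ hB)
      · intro x
        obtain ⟨B, hB, hx⟩ := hT.cov x (Nat.zero_le _) x.2
        obtain ⟨C, rfl⟩ := lift B hB
        have hx2 := (Finset.mem_map' Fin.valEmbedding (a := x)).1 hx
        refine ⟨C, ⟨(memf C).2 hB, hx2⟩, ?_⟩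
        rintro D ⟨hD, hxD⟩
        rw [memf] at hD
        exact inj (hT.dis _ hD _ hB x (Finset.mem_map_of_mem Fin.valEmbedding hxD) hx)
      · intro p q r s l1 l2 l3 B hB B' hB' hp hr hq hs
        rw [memf] at hB hB'
        exact inj (hT.nc p q r s l1 l2 l3 _ hB _ hB' (Finset.mem_map_of_mem Fin.valEmbedding hp)
          (Finset.mem_map_of_mem Fin.valEmbedding hr) (Finset.mem_map_of_mem Fin.valEmbedding hq)
          (Finset.mem_map_of_mem Fin.valEmbedding hs))
    · ext B
      rw [Finset.mem_map]
      constructor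
      · rintro ⟨C, hC, rfl⟩
        simpa using hC
      · intro hB
        refine ⟨Finset.univ.filter (fun x => (x:ℕ) ∈ B), ?_⟩
        have : (Finset.univ.filter (fun x : Fin p => (x:ℕ) ∈ B)).map Fin.valEmbedding = B := by
          ext x
          simp only [Finset.mem_map, Finset.mem_filter, Finset.mem_univ, true_and]
          constructor
          · rintro ⟨y, hy, rfl⟩; exact hy
          · intro hx; exact ⟨⟨x, (hT.sub _ hB _ hx).2⟩, hx, rfl⟩
        refine ⟨?_, this⟩
        rw [Finset.mem_filter]
        exact ⟨Finset.mem_univ _, by rw [this]; exact hB⟩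
  · intro S _
    rw [Finset.card_map]

theorem psC2 : PowerSeries.C (2:ℝ) = 2 := map_ofNat PowerSeries.C 2
theorem psC4 : PowerSeries.C (4:ℝ) = 4 := map_ofNat PowerSeries.C 4

theorem ncF_lin (c : ℝ) (n : ℕ) : ((n:ℝ) + 3) * ncF c 0 (n+2) =
    (2 * n + 3) * (1 + c) * ncF c 0 (n+1) - n * (1 - c)^2 * ncF c 0 n := by
  let M : PowerSeries ℝ := PowerSeries.mk (fun n => ncF c 0 n)
  have hM : M = 1 + PowerSeries.X * (PowerSeries.C (c-1) * M + M * M) := by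
    ext k
    rcases k with _ | k
    · simp [M, ncF_self]
    · rw [map_add, PowerSeries.coeff_succ_X_mul, map_add, PowerSeries.coeff_C_mul,
        PowerSeries.coeff_mul, PowerSeries.coeff_one,
        Finset.Nat.sum_antidiagonal_eq_sum_range_succ_mk]
      simp only [M, PowerSeries.coeff_mk]
      rw [ncF_conv]; simp
  let k : PowerSeries ℝ := PowerSeries.C (1-c)
  have hk : PowerSeries.C (c-1) = -k := by
    simp [k]
  rw [hk] at hM
  let W : PowerSeries ℝ := 1 + k * PowerSeries.X - 2 * (PowerSeries.X * M)
  have hW : W * W = (1 + k * PowerSeries.X) * (1 + k * PowerSeries.X) - 4 * PowerSeries.X := by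
    simp only [W]
    linear_combination (-4 * PowerSeries.X) * hM
  have hD := congrArg (PowerSeries.derivative ℝ) hW
  have d4 : (PowerSeries.derivative ℝ) (4 : PowerSeries ℝ) = 0 := by
    have : (4 : PowerSeries ℝ) = PowerSeries.C (4:ℝ) := psC4.symm
    rw [this]; exact PowerSeries.derivative_C
  have dk : (PowerSeries.derivative ℝ) k = 0 := PowerSeries.derivative_C
  simp only [Derivation.leibniz, map_sub, map_add, smul_eq_mul, PowerSeries.derivative_X,
    PowerSeries.derivative_one, d4, dk] at hD
  set W' := (PowerSeries.derivative ℝ) W with hW'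
  have hmain : W' + PowerSeries.X * (PowerSeries.C (2*(1-c)-4) * W') +
      PowerSeries.X * (PowerSeries.X * (PowerSeries.C ((1-c)^2) * W')) =
      PowerSeries.C (1-c-2) * W + PowerSeries.X * (PowerSeries.C ((1-c)^2) * W) := by
    have e1 : PowerSeries.C (2*(1-c)-4) = 2 * k - 4 := by simp [k, psC2, psC4]
    have e2 : PowerSeries.C ((1-c)^2) = k^2 := by simp [k]
    have e3 : PowerSeries.C (1-c-2) = k - 2 := by simp [k, psC2]
    rw [e1, e2, e3]
    have two : (2 : PowerSeries ℝ) ≠ 0 := by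
      have : (2 : PowerSeries ℝ) = PowerSeries.C (2:ℝ) := psC2.symm
      rw [this]; simp
    apply mul_left_cancel₀ two
    linear_combination W * hD - 2 * W' * hW
  have cW : ∀ m, PowerSeries.coeff (m+2) W = -2 * ncF c 0 (m+1) := by
    intro m
    have : W = 1 + PowerSeries.X * PowerSeries.C (1-c) - PowerSeries.X * (PowerSeries.C 2 * M) := by
      simp only [W, k]
      have : (2 : PowerSeries ℝ) = PowerSeries.C (2:ℝ) := psC2.symm
      rw [this]; ring
    rw [this, map_sub, map_add, PowerSeries.coeff_succ_X_mul, PowerSeries.coeff_succ_X_mul,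
      PowerSeries.coeff_C_mul]
    simp [M, PowerSeries.coeff_one, PowerSeries.coeff_C]
  have h := congrArg (PowerSeries.coeff (n+2)) hmain
  simp only [map_add, PowerSeries.coeff_succ_X_mul, PowerSeries.coeff_C_mul] at h
  simp only [hW', PowerSeries.coeff_derivative] at h
  have c3 := cW (n+1)
  have c2 := cW n
  rw [show n+1+2 = n+2+1 by ring, show n+1+1 = n+2 by ring] at c3
  rw [c3, show n+1+1 = n+2 by ring, c2] at h
  rcases n with _ | n
  · push_cast at h ⊢
    linarith
  · have c1 := cW n
    rw [show n+1+1 = n+2 by ring, c1] at h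
    push_cast at h ⊢
    linarith

noncomputable def Jm (c : ℝ) (n : ℕ) : ℝ :=
  ∫ x in (1 + c - 2 * Real.sqrt c)..(1 + c + 2 * Real.sqrt c),
    x ^ n * Real.sqrt (4 * c - (x - 1 - c) ^ 2)

theorem Jm_zero (c : ℝ) (hc : 0 < c) : Jm c 0 = 2 * Real.pi * c := by
  have h := intervalIntegral.smul_integral_comp_mul_add
    (fun x => Real.sqrt (4 * c - (x - 1 - c) ^ 2)) (2 * Real.sqrt c) (1 + c) (a := -1) (b := 1)
  have e : ∀ t : ℝ, Real.sqrt (4 * c - (2 * Real.sqrt c * t + (1 + c) - 1 - c) ^ 2) =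
      2 * Real.sqrt c * Real.sqrt (1 - t^2) := by
    intro t
    have : 4 * c - (2 * Real.sqrt c * t + (1 + c) - 1 - c) ^ 2 = (2 * Real.sqrt c)^2 * (1 - t^2) := by
      have := Real.sq_sqrt hc.le
      linear_combination (-4) * this
    rw [this, Real.sqrt_mul (by positivity), Real.sqrt_sq (by positivity)]
  simp only [e] at h
  rw [intervalIntegral.integral_const_mul, integral_sqrt_one_sub_sq] at h
  unfold Jm
  simp only [pow_zero, one_mul]
  rw [show 1 + c - 2 * Real.sqrt c = 2 * Real.sqrt c * -1 + (1 + c) by ring,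
    show 1 + c + 2 * Real.sqrt c = 2 * Real.sqrt c * 1 + (1 + c) by ring, ← h, smul_eq_mul]
  have := Real.sq_sqrt hc.le
  linear_combination 2 * Real.pi * this

theorem Jm_rec (c : ℝ) (hc : 0 < c) (n : ℕ) : ((n:ℝ) + 3) * Jm c (n+1) =
    (2 * n + 3) * (1 + c) * Jm c n - n * (1 - c)^2 * Jm c (n-1) := by
  have hs := Real.sq_sqrt hc.le
  have hs0 := Real.sqrt_nonneg c
  have hab : 1 + c - 2 * Real.sqrt c ≤ 1 + c + 2 * Real.sqrt c := by linarith
  have I : ∀ m, IntervalIntegrable (fun x : ℝ => x ^ m * Real.sqrt (4 * c - (x - 1 - c) ^ 2)) volume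
      (1 + c - 2 * Real.sqrt c) (1 + c + 2 * Real.sqrt c) := by
    intro m
    apply Continuous.intervalIntegrable
    fun_prop
  have key := intervalIntegral.integral_eq_sub_of_hasDerivAt_of_le hab
    (f := fun x => x ^ n * (4 * c - (x - 1 - c) ^ 2) * Real.sqrt (4 * c - (x - 1 - c) ^ 2))
    (f' := fun x => -((n:ℝ)+3) * (x ^ (n+1) * Real.sqrt (4 * c - (x - 1 - c) ^ 2)) +
      (2 * n + 3) * (1 + c) * (x ^ n * Real.sqrt (4 * c - (x - 1 - c) ^ 2)) -
      n * (1-c)^2 * (x ^ (n-1) * Real.sqrt (4 * c - (x - 1 - c) ^ 2)))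
    (by fun_prop) ?_ ?_
  · rw [intervalIntegral.integral_sub, intervalIntegral.integral_add,
      intervalIntegral.integral_const_mul, intervalIntegral.integral_const_mul,
      intervalIntegral.integral_const_mul] at key
    · have z1 : 4 * c - (1 + c - 2 * Real.sqrt c - 1 - c) ^ 2 = 0 := by linear_combination (-4) * hs
      have z2 : 4 * c - (1 + c + 2 * Real.sqrt c - 1 - c) ^ 2 = 0 := by linear_combination (-4) * hs
      rw [z1, z2] at key
      unfold Jm
      simp only [mul_zero, zero_mul, sub_zero] at key
      linarith
    · exact (I _).const_mul _
    · exact (I _).const_mul _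
    · exact ((I _).const_mul _).add ((I _).const_mul _)
    · exact (I _).const_mul _
  · intro x hx
    have hq : 0 < 4 * c - (x - 1 - c) ^ 2 := by
      have h1 := hx.1
      have h2 := hx.2
      nlinarith
    have d1 : HasDerivAt (fun x : ℝ => 4 * c - (x - 1 - c) ^ 2) (-(2 * (x - 1 - c))) x := by
      have := ((((hasDerivAt_id x).sub_const 1).sub_const c).pow 2).const_sub (4 * c)
      refine this.congr_deriv ?_
      simp
    have d2 := d1.sqrt hq.ne'
    have d3 := ((hasDerivAt_pow n x).mul d1).mul d2
    refine d3.congr_deriv ?_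
    have hsq := Real.sq_sqrt hq.le
    have hpos := Real.sqrt_pos.2 hq
    set r := Real.sqrt (4 * c - (x - 1 - c) ^ 2) with hr
    have e : (4 * c - (x - 1 - c) ^ 2) * (-(2 * (x - 1 - c)) / (2 * r)) = -(x-1-c) * r := by
      field_simp
      linear_combination (x - 1 - c) * hsq
    simp only [Pi.mul_apply]
    rw [mul_assoc (x^n), e]
    rcases n with _ | n
    · simp; ring
    · simp only [Nat.add_sub_cancel]; push_cast; ring
  · exact (((I _).const_mul _).add ((I _).const_mul _)).sub ((I _).const_mul _)

theorem Jm_eq (c : ℝ) (hc : 0 < c) : ∀ n, Jm c n = 2 * Real.pi * ncF c 0 (n+1) := by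
  intro n
  induction n using Nat.strong_induction_on with
  | _ n ih =>
    rcases n with _ | n
    · rw [Jm_zero c hc, ncF_conv]
      simp [ncF_self]
    · have h1 := Jm_rec c hc n
      have h2 := ncF_lin c n
      rw [ih n (by omega)] at h1
      have h3 : (n:ℝ) * (1 - c)^2 * Jm c (n-1) = n * (1-c)^2 * (2 * Real.pi * ncF c 0 n) := by
        rcases n with _ | n
        · simp
        · rw [ih _ (by omega)]; rfl
      rw [h3] at h1
      have : (n:ℝ) + 3 ≠ 0 := by positivity
      apply mul_left_cancel₀ this
      rw [h1]
      linear_combination (-(2 * Real.pi)) * h2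

theorem moment_eq_Jm (c : ℝ) (hc : 0 < c) (n : ℕ) :
    ∫ x, x ^ (n+1) ∂(freePoisson c) = Jm c n / (2 * Real.pi) := by
  have hs := Real.sq_sqrt hc.le
  have hs0 := Real.sqrt_nonneg c
  have hab : 1 + c - 2 * Real.sqrt c ≤ 1 + c + 2 * Real.sqrt c := by linarith
  have ha0 : 0 ≤ 1 + c - 2 * Real.sqrt c := by nlinarith [sq_nonneg (Real.sqrt c - 1)]
  let dens : ℝ → ENNReal := fun x => ENNReal.ofReal
        (if x ∈ Set.Icc (1 + c - 2 * Real.sqrt c) (1 + c + 2 * Real.sqrt c)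
          then Real.sqrt (4 * c - (x - 1 - c) ^ 2) / (2 * Real.pi * x) else 0)
  let g : ℝ → ℝ := (Set.Icc (1 + c - 2 * Real.sqrt c) (1 + c + 2 * Real.sqrt c)).indicator
    (fun x => x ^ n * Real.sqrt (4 * c - (x - 1 - c) ^ 2) / (2 * Real.pi))
  have hmeas : Measurable dens := by
    apply ENNReal.measurable_ofReal.comp
    apply Measurable.ite measurableSet_Icc
    · fun_prop
    · fun_prop
  have hlt : ∀ᵐ x ∂(volume : Measure ℝ), dens x < ⊤ := Filter.Eventually.of_forall fun x => ENNReal.ofReal_lt_top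
  have hg : (fun x => (dens x).toReal • x ^ (n+1)) = g := by
    funext x
    simp only [dens, g, Set.indicator]
    split_ifs with hx
    · have hx0 : 0 ≤ x := ha0.trans hx.1
      rw [ENNReal.toReal_ofReal (by positivity), smul_eq_mul]
      rcases eq_or_lt_of_le hx0 with e | e
      · subst e
        have : Real.sqrt (4 * c - (0 - 1 - c) ^ 2) = 0 := by
          apply Real.sqrt_eq_zero_of_nonpos
          nlinarith [sq_nonneg (1 - c)]
        rw [this]; simp
      · field_simp
        ring
    · simp
  have hgi : Integrable g := by
    apply IntegrableOn.integrable_indicator _ measurableSet_Icc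
    apply Continuous.integrableOn_Icc
    fun_prop
  unfold freePoisson
  change ∫ x, x ^ (n+1) ∂(_ + volume.withDensity dens) = _
  rw [integral_add_measure]
  · rw [integral_smul_measure, integral_dirac, integral_withDensity_eq_integral_toReal_smul hmeas hlt, hg]
    simp only [g]
    rw [integral_indicator measurableSet_Icc, integral_Icc_eq_integral_Ioc,
      ← intervalIntegral.integral_of_le hab, intervalIntegral.integral_div]
    simp [Jm]
  · apply Integrable.smul_measure _ ENNReal.ofReal_ne_top
    exact integrable_dirac (by simp)
  · rw [integrable_withDensity_iff_integrable_smul' hmeas hlt, hg]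
    exact hgi

/-- The `p`-th moment of the free Poisson distribution of parameter `c` equals
`∑_{σ ∈ NC(p)} c^{#σ}`, the sum over non-crossing partitions of `{1,…,p}` of `c`
raised to the number of blocks. -/
theorem freePoisson_moment_eq_sum_noncrossing (c : ℝ) (hc : 0 < c) (p : ℕ) (hp : 1 ≤ p) :
    ∫ x, x ^ p ∂(freePoisson c) =
      ∑ S ∈ Finset.univ.filter (fun S : Finset (Finset (Fin p)) => IsNCPartition S),
        c ^ S.card := by
  rw [← ncF_eq]
  obtain ⟨n, rfl⟩ : ∃ n, p = n + 1 := ⟨p - 1, by omega⟩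
  rw [moment_eq_Jm c hc, Jm_eq c hc]
  have := Real.pi_pos
  field_simp
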